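/- arXiv:2105.15119 — 2 statements merged into one kernel-verified Lean document; each statement's English description precedes it below -/
import Mathlib

section
/- Let T^a and T^f be random variables taking values in the positive integers {1,2,...} with E[T^a] < ∞, let τ ≥ 1 be an integer, let t_CM, t_PM ≥ 1 be integers, and let c_CM, c_PM, c_DT ≥ 0. For γ ∈ (0,1) define c̄_CM(γ) = c_CM + c_DT·(1−γ^{t_CM})/(1−γ), c̄_PM(γ) = c_PM + c_DT·(1−γ^{t_PM})/(1−γ), A(γ) = E[γ^{T^a+T^f}·1{T^f ≤ τ}], B(γ) = E[γ^{T^a+τ}·1{T^f > τ}], and J(γ) = (c̄_CM(γ)·A(γ) + c̄_PM(γ)·B(γ)) / (1 − γ^{t_CM}·A(γ) − γ^{t_PM}·B(γ)). Then the limit as γ → 1 from below of (1−γ)·J(γ) equals ((c_CM + t_CM·c_DT)·P(T^f ≤ τ) + (c_PM + t_PM·c_DT)·P(T^f > τ)) / (E[T^a] + E[min(T^f, τ)] + t_CM·P(T^f ≤ τ) + t_PM·P(T^f > τ)). -/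
open MeasureTheory ProbabilityTheory Filter

lemma aux_num {Ω : Type*} [MeasureSpace Ω] [IsProbabilityMeasure (ℙ : Measure Ω)]
    (M : Ω → ℕ) (hM : Measurable M) (p : Ω → Prop) [DecidablePred p]
    (hp : MeasurableSet {ω | p ω}) :
    Tendsto (fun γ : ℝ => ∫ ω, γ ^ (M ω) * (if p ω then (1 : ℝ) else 0))
      (nhdsWithin 1 (Set.Iio 1)) (nhds (ℙ {ω | p ω}).toReal) := by
  have h1 : (ℙ {ω | p ω}).toReal = ∫ ω, (if p ω then (1 : ℝ) else 0) := by
    have h := integral_indicator_one (μ := (ℙ : Measure Ω)) hp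
    rw [Measure.real] at h
    rw [← h]
    congr 1
    funext ω
    simp [Set.indicator_apply]
  rw [h1]
  have hpos : ∀ᶠ γ : ℝ in nhdsWithin 1 (Set.Iio 1), 0 < γ ∧ γ < 1 := by
    filter_upwards [self_mem_nhdsWithin, mem_nhdsWithin_of_mem_nhds (lt_mem_nhds one_pos)]
      with γ h1 h2 using ⟨h2, h1⟩
  apply tendsto_integral_filter_of_dominated_convergence (fun _ => (1 : ℝ))
  · refine Eventually.of_forall fun γ => Measurable.aestronglyMeasurable ?_
    exact ((measurable_of_countable (fun n : ℕ => γ ^ n)).comp hM).mul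
      (Measurable.ite hp measurable_const measurable_const)
  · filter_upwards [hpos] with γ hγ
    refine Eventually.of_forall fun ω => ?_
    have := pow_le_one₀ (n := M ω) hγ.1.le hγ.2.le
    have := pow_nonneg hγ.1.le (M ω)
    rw [Real.norm_eq_abs, abs_le]
    split_ifs <;> constructor <;> linarith
  · exact integrable_const _
  · refine Eventually.of_forall fun ω => ?_
    have hc : Continuous (fun γ : ℝ => γ ^ (M ω) * (if p ω then (1 : ℝ) else 0)) := by fun_prop
    have := (hc.tendsto 1).mono_left (nhdsWithin_le_nhds (s := Set.Iio 1))
    simpa using this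

lemma aux_den {Ω : Type*} [MeasureSpace Ω] [IsProbabilityMeasure (ℙ : Measure Ω)]
    (N : Ω → ℕ) (hN : Measurable N) (hI : Integrable (fun ω => (N ω : ℝ))) :
    Tendsto (fun γ : ℝ => ∫ ω, ∑ i ∈ Finset.range (N ω), γ ^ i)
      (nhdsWithin 1 (Set.Iio 1)) (nhds (∫ ω, (N ω : ℝ))) := by
  have hpos : ∀ᶠ γ : ℝ in nhdsWithin 1 (Set.Iio 1), 0 < γ ∧ γ < 1 := by
    filter_upwards [self_mem_nhdsWithin, mem_nhdsWithin_of_mem_nhds (lt_mem_nhds one_pos)]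
      with γ h1 h2 using ⟨h2, h1⟩
  apply tendsto_integral_filter_of_dominated_convergence (fun ω => (N ω : ℝ))
  · refine Eventually.of_forall fun γ => Measurable.aestronglyMeasurable ?_
    exact (measurable_of_countable (fun n : ℕ => ∑ i ∈ Finset.range n, γ ^ i)).comp hN
  · filter_upwards [hpos] with γ hγ
    refine Eventually.of_forall fun ω => ?_
    rw [Real.norm_eq_abs, abs_of_nonneg (Finset.sum_nonneg fun i _ => pow_nonneg hγ.1.le i)]
    calc ∑ i ∈ Finset.range (N ω), γ ^ i ≤ ∑ i ∈ Finset.range (N ω), (1 : ℝ) :=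
          Finset.sum_le_sum fun i _ => pow_le_one₀ hγ.1.le hγ.2.le
      _ = N ω := by simp
  · exact hI
  · refine Eventually.of_forall fun ω => ?_
    have hc : Continuous (fun γ : ℝ => ∑ i ∈ Finset.range (N ω), γ ^ i) := by fun_prop
    have := (hc.tendsto 1).mono_left (nhdsWithin_le_nhds (s := Set.Iio 1))
    simpa using this

lemma aux_geom (n : ℕ) : Tendsto (fun γ : ℝ => (1 - γ ^ n) / (1 - γ))
    (nhdsWithin 1 (Set.Iio 1)) (nhds (n : ℝ)) := by
  have hc : Continuous (fun γ : ℝ => ∑ i ∈ Finset.range n, γ ^ i) := by fun_prop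
  have := (hc.tendsto 1).mono_left (nhdsWithin_le_nhds (s := Set.Iio 1))
  simp only [one_pow, Finset.sum_const, Finset.card_range, nsmul_eq_mul, mul_one] at this
  refine this.congr' ?_
  filter_upwards [self_mem_nhdsWithin] with γ hγ
  have h : (1 : ℝ) - γ ≠ 0 := by
    have : γ < 1 := hγ
    linarith
  rw [eq_div_iff h]
  exact geom_sum_mul_neg γ n

/-- Average cost criterion: the limit of (1−γ)·J(γ) as γ → 1⁻, where J(γ) is the total
expected discounted cost of the τ-time-based-maintenance policy. -/
theorem stmt_4 {Ω : Type*} [MeasureSpace Ω] [IsProbabilityMeasure (ℙ : Measure Ω)]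
    (Ta Tf : Ω → ℕ) (hTa : Measurable Ta) (hTf : Measurable Tf)
    (hTa1 : ∀ ω, 1 ≤ Ta ω) (hTf1 : ∀ ω, 1 ≤ Tf ω)
    (hTaInt : Integrable (fun ω => (Ta ω : ℝ)))
    (τ tCM tPM : ℕ) (hτ : 1 ≤ τ) (htCM : 1 ≤ tCM) (htPM : 1 ≤ tPM)
    (cCM cPM cDT : ℝ) (hcCM : 0 ≤ cCM) (hcPM : 0 ≤ cPM) (hcDT : 0 ≤ cDT)
    (cbarCM cbarPM A B J : ℝ → ℝ)
    (hcbarCM : ∀ γ : ℝ, cbarCM γ = cCM + cDT * ((1 - γ ^ tCM) / (1 - γ)))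
    (hcbarPM : ∀ γ : ℝ, cbarPM γ = cPM + cDT * ((1 - γ ^ tPM) / (1 - γ)))
    (hA : ∀ γ : ℝ, A γ = ∫ ω, γ ^ (Ta ω + Tf ω) * (if Tf ω ≤ τ then (1 : ℝ) else 0))
    (hB : ∀ γ : ℝ, B γ = ∫ ω, γ ^ (Ta ω + τ) * (if τ < Tf ω then (1 : ℝ) else 0))
    (hJ : ∀ γ : ℝ, J γ = (cbarCM γ * A γ + cbarPM γ * B γ) /
        (1 - γ ^ tCM * A γ - γ ^ tPM * B γ)) :
    Tendsto (fun γ : ℝ => (1 - γ) * J γ) (nhdsWithin 1 (Set.Iio 1))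
      (nhds (((cCM + tCM * cDT) * (ℙ {ω | Tf ω ≤ τ}).toReal +
              (cPM + tPM * cDT) * (ℙ {ω | τ < Tf ω}).toReal) /
             ((∫ ω, (Ta ω : ℝ)) + (∫ ω, (min (Tf ω) τ : ℝ)) +
              tCM * (ℙ {ω | Tf ω ≤ τ}).toReal + tPM * (ℙ {ω | τ < Tf ω}).toReal))) := by
  have hs1 : MeasurableSet {ω | Tf ω ≤ τ} := hTf measurableSet_Iic
  have hs2 : MeasurableSet {ω | τ < Tf ω} := hTf measurableSet_Ioi
  have hAt := aux_num (fun ω => Ta ω + Tf ω) (hTa.add hTf) (fun ω => Tf ω ≤ τ) hs1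
  have hBt := aux_num (fun ω => Ta ω + τ) (hTa.add measurable_const) (fun ω => τ < Tf ω) hs2
  have hiA : Integrable (fun ω => if Tf ω ≤ τ then (1 : ℝ) else 0) := by
    refine (integrable_const (1 : ℝ)).mono'
      (Measurable.ite hs1 measurable_const measurable_const).aestronglyMeasurable ?_
    refine Eventually.of_forall fun ω => ?_
    split_ifs <;> simp
  have hiB : Integrable (fun ω => if τ < Tf ω then (1 : ℝ) else 0) := by
    refine (integrable_const (1 : ℝ)).mono'
      (Measurable.ite hs2 measurable_const measurable_const).aestronglyMeasurable ?_
    refine Eventually.of_forall fun ω => ?_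
    split_ifs <;> simp
  have hiM : Integrable (fun ω => (min (Tf ω) τ : ℝ)) := by
    refine (integrable_const (τ : ℝ)).mono' ?_ ?_
    · exact ((measurable_of_countable (fun n : ℕ => (min (n : ℝ) τ : ℝ))).comp
        hTf).aestronglyMeasurable
    · refine Eventually.of_forall fun ω => ?_
      rw [Real.norm_eq_abs, abs_of_nonneg (by positivity)]
      exact min_le_right _ _
  have hPA : (ℙ {ω | Tf ω ≤ τ}).toReal = ∫ ω, (if Tf ω ≤ τ then (1 : ℝ) else 0) := by
    have h := integral_indicator_one (μ := (ℙ : Measure Ω)) hs1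
    rw [Measure.real] at h
    rw [← h]
    congr 1
    funext ω
    simp [Set.indicator_apply]
  have hPB : (ℙ {ω | τ < Tf ω}).toReal = ∫ ω, (if τ < Tf ω then (1 : ℝ) else 0) := by
    have h := integral_indicator_one (μ := (ℙ : Measure Ω)) hs2
    rw [Measure.real] at h
    rw [← h]
    congr 1
    funext ω
    simp [Set.indicator_apply]
  let N : Ω → ℕ := fun ω => Ta ω + (if Tf ω ≤ τ then Tf ω + tCM else τ + tPM)
  have hN : Measurable N :=
    hTa.add (Measurable.ite hs1 (hTf.add measurable_const) measurable_const)
  have hNe : (fun ω => (N ω : ℝ)) = fun ω => (Ta ω : ℝ) + (min (Tf ω) τ : ℝ) +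
      tCM * (if Tf ω ≤ τ then (1 : ℝ) else 0) + tPM * (if τ < Tf ω then (1 : ℝ) else 0) := by
    funext ω
    by_cases h : Tf ω ≤ τ
    · have h' : (Tf ω : ℝ) ≤ τ := by exact_mod_cast h
      simp [N, h, not_lt.2 h]
      ring
    · have h2 : τ < Tf ω := not_le.1 h
      have h' : (τ : ℝ) ≤ Tf ω := by exact_mod_cast h2.le
      simp [N, h, h2, h']
      ring
  have hi1 := hTaInt.add hiM
  have hi2 := hi1.add (hiA.const_mul (tCM : ℝ))
  have hi3 := hi2.add (hiB.const_mul (tPM : ℝ))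
  have hNI : Integrable (fun ω => (N ω : ℝ)) := by
    rw [hNe]; exact hi3
  have hNint : ∫ ω, (N ω : ℝ) = (∫ ω, (Ta ω : ℝ)) + (∫ ω, (min (Tf ω) τ : ℝ)) +
              tCM * (ℙ {ω | Tf ω ≤ τ}).toReal + tPM * (ℙ {ω | τ < Tf ω}).toReal := by
    rw [hNe, hPA, hPB, ← integral_const_mul, ← integral_const_mul, ← integral_add hTaInt hiM]
    erw [← integral_add hi1 (hiA.const_mul (tCM : ℝ)),
      ← integral_add hi2 (hiB.const_mul (tPM : ℝ))]
    rfl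
  have hDt := aux_den N hN hNI
  have hN1 : (1 : ℝ) ≤ ∫ ω, (N ω : ℝ) := by
    have : ∫ _ω : Ω, (1 : ℝ) ≤ ∫ ω, (N ω : ℝ) := by
      refine integral_mono (integrable_const _) hNI fun ω => ?_
      have : 1 ≤ N ω := le_trans (hTa1 ω) (Nat.le_add_right _ _)
      have h2 : (1 : ℝ) ≤ (N ω : ℝ) := by exact_mod_cast this
      exact h2
    simpa using this
  have hnum : Tendsto (fun γ => cbarCM γ * A γ + cbarPM γ * B γ) (nhdsWithin 1 (Set.Iio 1))
      (nhds ((cCM + tCM * cDT) * (ℙ {ω | Tf ω ≤ τ}).toReal +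
              (cPM + tPM * cDT) * (ℙ {ω | τ < Tf ω}).toReal)) := by
    simp only [hcbarCM, hcbarPM, hA, hB, mul_comm _ cDT]
    exact ((tendsto_const_nhds.add (tendsto_const_nhds.mul (aux_geom tCM))).mul hAt).add
      ((tendsto_const_nhds.add (tendsto_const_nhds.mul (aux_geom tPM))).mul hBt)
  rw [← hNint]
  refine (hnum.div hDt (by linarith)).congr' ?_
  filter_upwards [self_mem_nhdsWithin, mem_nhdsWithin_of_mem_nhds (lt_mem_nhds one_pos)]
    with γ h1 h0
  have h1' : γ < 1 := h1
  have hne : (1 : ℝ) - γ ≠ 0 := by linarith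
  have hbd : ∀ (M : Ω → ℕ), Measurable M → Integrable (fun ω => γ ^ M ω) := by
    intro M hM
    refine (integrable_const (1 : ℝ)).mono'
      ((measurable_of_countable (fun n : ℕ => γ ^ n)).comp hM).aestronglyMeasurable ?_
    refine Eventually.of_forall fun ω => ?_
    rw [Real.norm_eq_abs, abs_of_nonneg (pow_nonneg h0.le _)]
    exact pow_le_one₀ h0.le h1'.le
  have hIA : Integrable (fun ω => γ ^ (Ta ω + Tf ω) * (if Tf ω ≤ τ then (1 : ℝ) else 0)) := by
    refine ((hbd _ (hTa.add hTf)).indicator hs1).congr (Eventually.of_forall fun ω => ?_)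
    by_cases h : Tf ω ≤ τ <;> simp [h]
  have hIB : Integrable (fun ω => γ ^ (Ta ω + τ) * (if τ < Tf ω then (1 : ℝ) else 0)) := by
    refine ((hbd (fun ω => Ta ω + τ) (hTa.add measurable_const)).indicator hs2).congr
      (Eventually.of_forall fun ω => ?_)
    by_cases h : τ < Tf ω <;> simp [h]
  have hNg : ∫ ω, γ ^ N ω = γ ^ tCM * A γ + γ ^ tPM * B γ := by
    rw [hA, hB, ← integral_const_mul, ← integral_const_mul,
      ← integral_add (hIA.const_mul _) (hIB.const_mul _)]
    congr 1
    funext ω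
    by_cases h : Tf ω ≤ τ
    · simp [N, h, not_lt.2 h]
      ring
    · simp [N, h, not_le.1 h]
      ring
  have hden : (∫ ω, ∑ i ∈ Finset.range (N ω), γ ^ i) * (1 - γ)
      = 1 - γ ^ tCM * A γ - γ ^ tPM * B γ := by
    rw [← integral_mul_const]
    simp only [geom_sum_mul_neg]
    rw [integral_sub (integrable_const _) (hbd N hN), hNg]
    simp
    ring
  simp only [Pi.div_apply]
  rw [hJ, ← hden]
  by_cases hz : (∫ ω, ∑ i ∈ Finset.range (N ω), γ ^ i) = 0
  · simp [hz]
  · field_simp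
end

section
/- Let γ ∈ (0,1), let c̄_CM, c̄_PM ≥ 0, let S be a finite index set, and let c̄'_{m'} ≥ 0 for each m' ∈ S. Assume γ·c̄_CM − c̄_PM > ∑_{m'∈S} (1−γ)·c̄'_{m'}. Then for every natural number t and every family of natural numbers (t_{m'})_{m'∈S} with t_{m'} ≥ t for all m' ∈ S, one has γ^{t+1}·c̄_CM + ∑_{m'∈S} γ^{t_{m'}+1}·c̄'_{m'} > γ^t·c̄_PM + ∑_{m'∈S} γ^{t_{m'}}·c̄'_{m'}. -/
/-- TMH condition (iii): it is loss-making to perform corrective maintenance one period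
later instead of preventive maintenance now in order to delay, by one period each, an
arbitrary number of other (no earlier) preventive maintenance actions. -/
theorem stmt_7 {ι : Type*} (S : Finset ι)
    (γ : ℝ) (hγ0 : 0 < γ) (hγ1 : γ < 1)
    (cbarCM cbarPM : ℝ) (hcbarCM : 0 ≤ cbarCM) (hcbarPM : 0 ≤ cbarPM)
    (c' : ι → ℝ) (hc' : ∀ m' ∈ S, 0 ≤ c' m')
    (hcond : γ * cbarCM - cbarPM > ∑ m' ∈ S, (1 - γ) * c' m') :
    ∀ (t : ℕ) (tm : ι → ℕ), (∀ m' ∈ S, t ≤ tm m') →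
      γ ^ (t + 1) * cbarCM + ∑ m' ∈ S, γ ^ (tm m' + 1) * c' m' >
        γ ^ t * cbarPM + ∑ m' ∈ S, γ ^ (tm m') * c' m' := by
  intro t tm htm
  have h1 : ∑ m' ∈ S, γ ^ (tm m') * c' m' - ∑ m' ∈ S, γ ^ (tm m' + 1) * c' m'
      ≤ γ ^ t * ∑ m' ∈ S, (1 - γ) * c' m' := by
    rw [← Finset.sum_sub_distrib, Finset.mul_sum]
    refine Finset.sum_le_sum fun m hm => ?_
    have h2 : γ ^ (tm m) ≤ γ ^ t := pow_le_pow_of_le_one hγ0.le hγ1.le (htm m hm)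
    have h3 : 0 ≤ (1 - γ) * c' m := mul_nonneg (by linarith) (hc' m hm)
    have h4 := mul_le_mul_of_nonneg_right h2 h3
    have h5 : γ ^ (tm m) * c' m - γ ^ (tm m + 1) * c' m = γ ^ (tm m) * ((1 - γ) * c' m) := by
      ring
    rw [h5]
    exact h4
  have h6 := mul_lt_mul_of_pos_left hcond (pow_pos hγ0 t)
  have h7 : γ ^ t * (γ * cbarCM - cbarPM) = γ ^ (t + 1) * cbarCM - γ ^ t * cbarPM := by ring
  rw [h7] at h6
  linarith
end
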